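/- Every 4-connected graph that is both K_{1,3}-free and Z₁-free contains the square of a Hamiltonian cycle. -/

import Mathlib

/-- `G` contains the square of a Hamiltonian cycle: there is a cyclic ordering of
all vertices such that consecutive vertices and vertices at distance two on the
cycle are adjacent in `G`. -/
def HasH2 {V : Type*} [Fintype V] (G : SimpleGraph V) : Prop :=
  ∃ e : ZMod (Fintype.card V) ≃ V,
    ∀ i : ZMod (Fintype.card V), G.Adj (e i) (e (i + 1)) ∧ G.Adj (e i) (e (i + 2))

/-- `F` occurs as an induced subgraph of `G`. -/
def ContainsInduced {W V : Type*} (F : SimpleGraph W) (G : SimpleGraph V) : Prop :=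
  ∃ f : W ↪ V, ∀ a b, F.Adj a b ↔ G.Adj (f a) (f b)

/-- `Z₁`: the triangle with a pendant edge (claw plus an edge between two leaves). -/
def Z1Graph : SimpleGraph (Fin 4) :=
  SimpleGraph.fromRel (fun a b => (a, b) ∈ ([(0,1),(0,2),(1,2),(2,3)] : List (Fin 4 × Fin 4)))

/-- The star `K_{1,r}` with center `0` and `r` leaves. -/
def starGraph (r : ℕ) : SimpleGraph (Fin (r + 1)) :=
  SimpleGraph.fromRel (fun a _ => a = 0)

/-- A graph is `k`-connected if it has more than `k` vertices and deleting any
set of fewer than `k` vertices leaves it connected. -/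
def IsKConnected {V : Type*} [Fintype V] (G : SimpleGraph V) (k : ℕ) : Prop :=
  k < Fintype.card V ∧
    ∀ S : Finset V, S.card < k → (G.induce ((S : Set V)ᶜ)).Connected

theorem aux_list {V : Type*} [DecidableEq V] (R : V → V → Prop)
    (hsymm : ∀ a b, R a b → R b a) (hirr : ∀ a, ¬ R a a)
    (hm : ∀ a b c, R a b → R a c → b = c) :
    ∀ (n : ℕ) (S : Finset V), S.card ≤ n →
      ∃ L : List V, L.Nodup ∧ (∀ v, v ∈ L ↔ v ∈ S) ∧
        ∀ (i j : ℕ) (hi : i < L.length) (hj : j < L.length), R L[i] L[j] → i / 2 = j / 2 := by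
  intro n
  induction n with
  | zero =>
    intro S hS
    have : S = ∅ := by simpa using hS
    subst this
    exact ⟨[], by simp⟩
  | succ n ih =>
    intro S hS
    by_cases h : ∃ a ∈ S, ∃ b ∈ S, R a b
    · obtain ⟨a, ha, b, hb, hab⟩ := h
      have hne : a ≠ b := fun h => hirr a (by rw [← h] at hab; exact hab)
      have hlt : ((S.erase a).erase b).card ≤ n := by
        have h1 := Finset.card_erase_lt_of_mem ha
        have h2 := Finset.card_erase_le (s := S.erase a) (a := b)
        omega
      obtain ⟨L, hnd, hmem, hR⟩ := ih _ hlt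
      have haL : a ∉ L := by simp [hmem]
      have hbL : b ∉ L := by simp [hmem]
      refine ⟨a :: b :: L, by simp [hnd, haL, hbL, hne], ?_, ?_⟩
      · intro v
        simp only [List.mem_cons, hmem, Finset.mem_erase]
        by_cases h1 : v = a
        · simp [h1, ha]
        · by_cases h2 : v = b
          · simp [h2, hb]
          · simp [h1, h2]
      · have hA : ∀ x ∈ L, ¬ R a x := fun x hx hr => hbL (hm a b x hab hr ▸ hx)
        have hB : ∀ x ∈ L, ¬ R b x := fun x hx hr =>
          haL (hm b a x (hsymm _ _ hab) hr ▸ hx)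
        intro i j hi hj hr
        match i, j with
        | 0, 0 => rfl
        | 0, 1 => rfl
        | 1, 0 => rfl
        | 1, 1 => rfl
        | 0, j+2 => exact absurd hr (hA _ (List.getElem_mem _))
        | 1, j+2 => exact absurd hr (hB _ (List.getElem_mem _))
        | i+2, 0 => exact absurd (hsymm _ _ hr) (hA _ (List.getElem_mem _))
        | i+2, 1 => exact absurd (hsymm _ _ hr) (hB _ (List.getElem_mem _))
        | i+2, j+2 =>
          have := hR i j (by simpa using hi) (by simpa using hj) hr
          omega
    · push Not at h
      refine ⟨S.toList, S.nodup_toList, by simp, ?_⟩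
      intro i j hi hj hr
      exact absurd hr (h _ (by rw [← Finset.mem_toList]; exact List.getElem_mem _) _
        (by rw [← Finset.mem_toList]; exact List.getElem_mem _))

theorem aux_matching {V : Type*} [Fintype V] (G : SimpleGraph V)
    (h6 : 6 ≤ Fintype.card V)
    (hm : ∀ a b c, a ≠ b → ¬ G.Adj a b → a ≠ c → ¬ G.Adj a c → b = c) : HasH2 G := by
  classical
  obtain ⟨L, hnd, hmem, hR⟩ := aux_list (fun a b => a ≠ b ∧ ¬ G.Adj a b)
    (fun a b h => ⟨h.1.symm, fun h' => h.2 h'.symm⟩) (fun a h => h.1 rfl)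
    (fun a b c h h' => hm a b c h.1 h.2 h'.1 h'.2) _ (Finset.univ : Finset V) le_rfl
  have hlen : L.length = Fintype.card V := by
    rw [← List.toFinset_card_of_nodup hnd, ← Finset.card_univ]
    congr 1
    ext v; simp [hmem]
  obtain ⟨n, hn⟩ : ∃ n, n = Fintype.card V := ⟨_, rfl⟩
  unfold HasH2
  rw [← hn] at h6 hlen ⊢
  have : NeZero n := ⟨by omega⟩
  obtain ⟨k, hk⟩ : ∃ k, k = n / 2 := ⟨_, rfl⟩
  let σ : ℕ → ℕ := fun i => if i < k then 2 * i else if i < 2 * k then 2 * (i - k) + 1 else i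
  have hσ : ∀ p, p < n → σ p < n := by
    intro p hp; simp only [σ]; split_ifs <;> omega
  have hσi : ∀ p q, p < n → q < n → σ p = σ q → p = q := by
    intro p q hp hq; simp only [σ]; split_ifs <;> omega
  have hσ2 : ∀ p q, p < n → q < n → σ p / 2 = σ q / 2 → p = q ∨ p = q + k ∨ q = p + k := by
    intro p q hp hq; simp only [σ]; split_ifs <;> omega
  let f : ZMod n → V := fun i => L[σ i.val]'(by rw [hlen]; exact hσ _ (ZMod.val_lt i))
  have hf : Function.Injective f := by
    intro i j hij
    have h1 := (List.Nodup.getElem_inj_iff hnd).1 hij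
    exact ZMod.val_injective n (hσi _ _ (ZMod.val_lt i) (ZMod.val_lt j) h1)
  have hb : Function.Bijective f :=
    (Fintype.bijective_iff_injective_and_card f).2 ⟨hf, by rw [ZMod.card, hn]⟩
  have key : ∀ i j : ZMod n, i ≠ j → i.val + k ≠ j.val → j.val + k ≠ i.val →
      G.Adj (f i) (f j) := by
    intro i j hij h1 h2
    by_contra hadj
    have h3 := hR _ _ (by rw [hlen]; exact hσ _ (ZMod.val_lt i))
      (by rw [hlen]; exact hσ _ (ZMod.val_lt j)) ⟨fun h => hij (hf h), hadj⟩
    rcases hσ2 _ _ (ZMod.val_lt i) (ZMod.val_lt j) h3 with h | h | h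
    · exact hij (ZMod.val_injective n h)
    · omega
    · omega
  have hadd : ∀ (i : ZMod n) (d : ℕ), d = 1 ∨ d = 2 → G.Adj (f i) (f (i + (d : ZMod n))) := by
    intro i d hd
    have hi := ZMod.val_lt i
    have hv : (i + (d : ZMod n)).val = (i.val + d) % n := by
      rw [ZMod.val_add, ZMod.val_natCast, Nat.add_mod_mod]
    have hv2 : (i + (d : ZMod n)).val = i.val + d ∨
        (i + (d : ZMod n)).val + n = i.val + d := by
      rw [hv]
      by_cases hlt : i.val + d < n
      · left; exact Nat.mod_eq_of_lt hlt
      · right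
        rw [Nat.mod_eq_sub_mod (by omega), Nat.mod_eq_of_lt (by omega)]; omega
    apply key
    · intro h
      rw [← h] at hv2
      omega
    · omega
    · omega
  refine ⟨Equiv.ofBijective f hb, fun i => ⟨?_, ?_⟩⟩
  · simpa using hadd i 1 (Or.inl rfl)
  · simpa using hadd i 2 (Or.inr rfl)

theorem aux_complete {V : Type*} [Fintype V] (G : SimpleGraph V)
    (h5 : 4 < Fintype.card V) (hc : ∀ a b, a ≠ b → G.Adj a b) : HasH2 G := by
  classical
  unfold HasH2
  obtain ⟨n, hn⟩ : ∃ n, n = Fintype.card V := ⟨_, rfl⟩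
  have e0 := Fintype.equivFinOfCardEq hn.symm
  rw [← hn] at h5 ⊢
  have : NeZero n := ⟨by omega⟩
  have e : ZMod n ≃ V := Fintype.equivOfCardEq (by rw [ZMod.card, hn])
  have hd : ∀ d : ℕ, 0 < d → d < n → (d : ZMod n) ≠ 0 := by
    intro d h0 h1 h
    rw [ZMod.natCast_eq_zero_iff] at h
    exact absurd (Nat.le_of_dvd h0 h) (by omega)
  refine ⟨e, fun i => ⟨hc _ _ ?_, hc _ _ ?_⟩⟩
  · intro h
    have := e.injective h
    have h1 := hd 1 (by omega) (by omega)
    simp at this h1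
    exact h1 this
  · intro h
    have := e.injective h
    have h1 := hd 2 (by omega) (by omega)
    simp at this
    exact h1 (by simpa using this)

theorem aux_degree {V : Type*} [Fintype V] [DecidableEq V] (G : SimpleGraph V)
    [DecidableRel G.Adj] (h4 : IsKConnected G 4) (v : V) : 4 ≤ (G.neighborFinset v).card := by
  by_contra hlt
  push Not at hlt
  have hc := h4.2 _ hlt
  have hcard := h4.1
  obtain ⟨w, hw⟩ : ∃ w, w ∉ insert v (G.neighborFinset v) := by
    by_contra h
    push Not at h
    have h1 : (Finset.univ : Finset V) ⊆ insert v (G.neighborFinset v) := fun x _ => h x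
    have h2 := Finset.card_le_card h1
    have h3 := Finset.card_insert_le v (G.neighborFinset v)
    rw [Finset.card_univ] at h2
    omega
  simp only [Finset.mem_insert, not_or] at hw
  have hr := hc.preconnected
    ⟨v, by simp⟩ ⟨w, by simpa using hw.2⟩
  obtain ⟨p⟩ := hr
  cases p with
  | nil => exact hw.1 rfl
  | cons h _ =>
    rename_i x _
    exact x.2 (by simpa using h)

/-- Every 4-connected `{K_{1,3}, Z₁}`-free graph contains the square of a
Hamiltonian cycle. -/
theorem fourConnected_claw_z1_free_h2 {V : Type*} [Fintype V] (G : SimpleGraph V)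
    (h4 : IsKConnected G 4)
    (hclaw : ¬ContainsInduced (starGraph 3) G)
    (hz1 : ¬ContainsInduced Z1Graph G) :
    HasH2 G := by
  classical
  have claw : ∀ c x y z, G.Adj c x → G.Adj c y → G.Adj c z → x ≠ y → x ≠ z → y ≠ z →
      G.Adj x y ∨ G.Adj x z ∨ G.Adj y z := by
    intro c x y z hx hy hz hxy hxz hyz
    by_contra hno
    push Not at hno
    obtain ⟨n1, n2, n3⟩ := hno
    apply hclaw
    refine ⟨⟨![c, x, y, z], ?_⟩, ?_⟩
    · intro a b
      have := hx.ne; have := hy.ne; have := hz.ne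
      fin_cases a <;> fin_cases b <;> simp_all [eq_comm]
    · intro a b
      change _ ↔ G.Adj (![c, x, y, z] a) (![c, x, y, z] b)
      have m1 := mt SimpleGraph.Adj.symm n1; have m2 := mt SimpleGraph.Adj.symm n2; have m3 := mt SimpleGraph.Adj.symm n3
      fin_cases a <;> fin_cases b <;>
        simp [starGraph, hx, hy, hz, hx.symm, hy.symm, hz.symm, n1, n2, n3, m1, m2, m3]
  have paw : ∀ x y z w, G.Adj x y → G.Adj x z → G.Adj y z → G.Adj z w → w ≠ x → w ≠ y →
      G.Adj w x ∨ G.Adj w y := by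
    intro x y z w hxy hxz hyz hzw hwx hwy
    by_contra hno
    push Not at hno
    obtain ⟨n1, n2⟩ := hno
    apply hz1
    refine ⟨⟨![x, y, z, w], ?_⟩, ?_⟩
    · intro a b
      have := hxy.ne; have := hxz.ne; have := hyz.ne; have := hzw.ne
      fin_cases a <;> fin_cases b <;> simp_all [eq_comm]
    · intro a b
      change _ ↔ G.Adj (![x, y, z, w] a) (![x, y, z, w] b)
      have m1 := mt SimpleGraph.Adj.symm n1; have m2 := mt SimpleGraph.Adj.symm n2
      fin_cases a <;> fin_cases b <;>
        simp [Z1Graph, hxy, hxz, hyz, hzw, hxy.symm, hxz.symm, hyz.symm, hzw.symm, n1, n2, m1, m2]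
  have tri : ∀ v, ∃ x y, G.Adj v x ∧ G.Adj v y ∧ G.Adj x y := by
    intro v
    have hd := aux_degree G h4 v
    obtain ⟨x, y, z, hx, hy, hz, hxy, hxz, hyz⟩ := Finset.two_lt_card_iff.1
      (show 2 < (G.neighborFinset v).card by omega)
    rw [SimpleGraph.mem_neighborFinset] at hx hy hz
    rcases claw v x y z hx hy hz hxy hxz hyz with h | h | h
    · exact ⟨x, y, hx, hy, h⟩
    · exact ⟨x, z, hx, hz, h⟩
    · exact ⟨y, z, hy, hz, h⟩
  have hpre : G.Preconnected := by
    intro u v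
    have hc := (h4.2 ∅ (by simp)).preconnected ⟨u, by simp⟩ ⟨v, by simp⟩
    exact hc.map (SimpleGraph.Embedding.induce _).toHom
  have dom : ∀ x y z, G.Adj x y → G.Adj x z → G.Adj y z → ∀ w,
      (w = x ∨ G.Adj w x) ∧ (w = y ∨ G.Adj w y) ∨
      (w = x ∨ G.Adj w x) ∧ (w = z ∨ G.Adj w z) ∨
      (w = y ∨ G.Adj w y) ∧ (w = z ∨ G.Adj w z) := by
    intro x y z hxy hxz hyz w
    have close : ∀ x y z, G.Adj x y → G.Adj x z → G.Adj y z → ∀ w, G.Adj x w →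
      (w = x ∨ G.Adj w x) ∧ (w = y ∨ G.Adj w y) ∨
      (w = x ∨ G.Adj w x) ∧ (w = z ∨ G.Adj w z) := by
      intro x y z hxy hxz hyz w hw
      have := paw y z x w hyz hxy.symm hxz.symm hw
      have := hw.symm
      tauto
    have step : ∀ x y u w, G.Adj x y → G.Adj u x → G.Adj u y → G.Adj u w →
        (w = x ∨ G.Adj w x) ∨ (w = y ∨ G.Adj w y) := by
      intro x y u w hxy hux huy huw
      have := paw x y u w hxy hux.symm huy.symm huw
      tauto
    obtain ⟨p⟩ := (hpre x w)
    clear hpre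
    have hgen : ∀ {u w : V} (p : G.Walk u w),
      ((u = x ∨ G.Adj u x) ∧ (u = y ∨ G.Adj u y) ∨
      (u = x ∨ G.Adj u x) ∧ (u = z ∨ G.Adj u z) ∨
      (u = y ∨ G.Adj u y) ∧ (u = z ∨ G.Adj u z)) →
      ((w = x ∨ G.Adj w x) ∧ (w = y ∨ G.Adj w y) ∨
      (w = x ∨ G.Adj w x) ∧ (w = z ∨ G.Adj w z) ∨
      (w = y ∨ G.Adj w y) ∧ (w = z ∨ G.Adj w z)) := by
      intro u w p
      induction p with
      | nil => exact id
      | @cons u v w h p ih =>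
        intro hu
        apply ih
        have cx := close x y z hxy hxz hyz v
        have cy := close y x z hxy.symm hyz hxz v
        have cz := close z x y hxz.symm hyz.symm hxy v
        have fx : G.Adj x v → (v = x ∨ G.Adj v x) ∧ (v = y ∨ G.Adj v y) ∨
            (v = x ∨ G.Adj v x) ∧ (v = z ∨ G.Adj v z) ∨
            (v = y ∨ G.Adj v y) ∧ (v = z ∨ G.Adj v z) :=
          fun h => (cx h).imp id Or.inl
        have fy : G.Adj y v → (v = x ∨ G.Adj v x) ∧ (v = y ∨ G.Adj v y) ∨
            (v = x ∨ G.Adj v x) ∧ (v = z ∨ G.Adj v z) ∨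
            (v = y ∨ G.Adj v y) ∧ (v = z ∨ G.Adj v z) :=
          fun h => (cy h).imp And.symm Or.inr
        have fz : G.Adj z v → (v = x ∨ G.Adj v x) ∧ (v = y ∨ G.Adj v y) ∨
            (v = x ∨ G.Adj v x) ∧ (v = z ∨ G.Adj v z) ∨
            (v = y ∨ G.Adj v y) ∧ (v = z ∨ G.Adj v z) :=
          fun h => Or.inr ((cz h).imp And.symm And.symm)
        by_cases ux : u = x
        · exact fx (ux ▸ h)
        by_cases uy : u = y
        · exact fy (uy ▸ h)
        by_cases uz : u = z
        · exact fz (uz ▸ h)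
        have hxy' := hxy.symm
        have hxz' := hxz.symm
        have hyz' := hyz.symm
        have fin : ∀ t, (t = x ∨ t = y ∨ t = z) → (v = t ∨ G.Adj v t) →
          ((v = x ∨ G.Adj v x) ∧ (v = y ∨ G.Adj v y) ∨
          (v = x ∨ G.Adj v x) ∧ (v = z ∨ G.Adj v z) ∨
          (v = y ∨ G.Adj v y) ∧ (v = z ∨ G.Adj v z)) := by
          rintro t (rfl | rfl | rfl) (rfl | h)
          · exact Or.inl ⟨Or.inl rfl, Or.inr hxy⟩
          · exact fx h.symm
          · exact Or.inl ⟨Or.inr hxy', Or.inl rfl⟩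
          · exact fy h.symm
          · exact Or.inr (Or.inl ⟨Or.inr hxz', Or.inl rfl⟩)
          · exact fz h.symm
        simp only [ux, uy, uz, false_or] at hu
        rcases hu with ⟨h1, h2⟩ | ⟨h1, h2⟩ | ⟨h1, h2⟩
        · rcases step x y u v hxy h1 h2 h with h' | h'
          · exact fin x (by simp) h'
          · exact fin y (by simp) h'
        · rcases step x z u v hxz h1 h2 h with h' | h'
          · exact fin x (by simp) h'
          · exact fin z (by simp) h'
        · rcases step y z u v hyz h1 h2 h with h' | h'
          · exact fin y (by simp) h'
          · exact fin z (by simp) h'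
    exact hgen p (Or.inl ⟨Or.inl rfl, Or.inr hxy⟩)
  have hm : ∀ a b c, a ≠ b → ¬ G.Adj a b → a ≠ c → ¬ G.Adj a c → b = c := by
    intro a b c hab nab hac nac
    by_contra hbc
    by_cases hadj : G.Adj b c
    · have : ∃ z, G.Adj b z ∧ G.Adj c z := by
        obtain ⟨x, y, hx, hy, hxy⟩ := tri b
        by_cases h1 : c = x
        · subst h1; exact ⟨y, hy, hxy⟩
        by_cases h2 : c = y
        · subst h2; exact ⟨x, hx, hxy.symm⟩
        rcases paw x y b c hxy hx.symm hy.symm hadj h1 h2 with h | h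
        · exact ⟨x, hx, h⟩
        · exact ⟨y, hy, h⟩
      obtain ⟨z, hbz, hcz⟩ := this
      have := dom b c z hadj hbz hcz a
      tauto
    · obtain ⟨x, y, hx, hy, hxy⟩ := tri a
      have key : ∀ d, a ≠ d → ¬ G.Adj a d → G.Adj x d := by
        intro d had nad
        have h1 := dom a x y hx hy hxy d
        have h2 : ¬ (d = a ∨ G.Adj d a) := by
          rintro (h | h)
          · exact had h.symm
          · exact nad h.symm
        have h3 : d = x ∨ G.Adj d x := by tauto
        rcases h3 with h | h
        · exact absurd (h ▸ hx) nad
        · exact h.symm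
      have := claw x a b c hx.symm (key b hab nab) (key c hac nac) hab hac hbc
      tauto
  by_cases hcomp : ∀ a b, a ≠ b → G.Adj a b
  · exact aux_complete G h4.1 hcomp
  · push Not at hcomp
    obtain ⟨a, b, hab, nab⟩ := hcomp
    refine aux_matching G ?_ hm
    have hd := aux_degree G h4 a
    have h1 : (insert a (insert b (G.neighborFinset a))).card = (G.neighborFinset a).card + 2 := by
      rw [Finset.card_insert_of_notMem (by simp [hab]), Finset.card_insert_of_notMem (by simpa using nab)]
    have h2 := Finset.card_le_univ (insert a (insert b (G.neighborFinset a)))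
    omega
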